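/- Let (T,Σ,μ) be a measure space and F_n : T ⇉ ℝ^ℓ correspondences all integrably bounded by the same integrable function g : T → ℝ₊ (i.e., ‖x‖ ≤ g(t) for all x ∈ F_n(t)). Then Ls ∫_T F_n dμ ⊆ ∫_T Ls F_n dμ, where the integral of a correspondence is the Aumann integral (the set of integrals of its integrable selections), and Ls applied to sets of ℝ^ℓ is the Kuratowski upper limit. -/

import Mathlib

open Filter MeasureTheory

/-- The Aumann integral of a correspondence: the set of integrals of its
(a.e.) integrable selections. -/
def aumannIntegral {T : Type*} [MeasurableSpace T] (μ : Measure T) {ℓ : ℕ}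
    (F : T → Set (Fin ℓ → ℝ)) : Set (Fin ℓ → ℝ) :=
  {y | ∃ f : T → Fin ℓ → ℝ, Integrable f μ ∧ (∀ᵐ t ∂μ, f t ∈ F t) ∧ (∫ t, f t ∂μ) = y}

/-- The Kuratowski upper limit (set of cluster points) of a sequence of sets. -/
def kuratowskiLs {ℓ : ℕ} (A : ℕ → Set (Fin ℓ → ℝ)) : Set (Fin ℓ → ℝ) :=
  {x | ∃ φ : ℕ → ℕ, StrictMono φ ∧ ∃ xk : ℕ → Fin ℓ → ℝ,
    (∀ k, xk k ∈ A (φ k)) ∧ Tendsto xk atTop (nhds x)}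

open scoped Topology

/-- A nonempty convex set in a finite-dimensional space can be weakly separated from any point
outside it, with no closedness assumption. -/
theorem Convex.exists_ne_zero_forall_nonpos {V : Type*} [NormedAddCommGroup V] [NormedSpace ℝ V]
    [FiniteDimensional ℝ V] {C : Set V} (hC : Convex ℝ C) (hne : C.Nonempty) (h0 : (0 : V) ∉ C) :
    ∃ p : V →ₗ[ℝ] ℝ, p ≠ 0 ∧ ∀ v ∈ C, p v ≤ 0 := by
  by_cases hint : (interior C).Nonempty
  · obtain ⟨p, hp, hpC⟩ :=
      geometric_hahn_banach_of_nonempty_interior_point hC (fun h => h0 (interior_subset h)) hint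
    refine ⟨p.toLinearMap, fun h => hp ?_, fun v hv => by simpa using hpC v hv⟩
    ext v
    exact LinearMap.congr_fun h v
  · rw [hC.interior_nonempty_iff_affineSpan_eq_top] at hint
    have hdir : (affineSpan ℝ C).direction ≠ ⊤ := by
      rwa [Ne, AffineSubspace.direction_eq_top_iff_of_nonempty ((affineSpan_nonempty ℝ).2 hne)]
    obtain ⟨p, hp, hker⟩ := Submodule.exists_le_ker_of_lt_top _ hdir.lt_top
    obtain ⟨v₀, hv₀⟩ := hne
    have hconst : ∀ v ∈ C, p v = p v₀ := by
      intro v hv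
      have := hker (AffineSubspace.vsub_mem_direction (subset_affineSpan ℝ C hv)
        (subset_affineSpan ℝ C hv₀))
      rw [LinearMap.mem_ker, vsub_eq_sub, map_sub, sub_eq_zero] at this
      exact this
    rcases le_total (p v₀) 0 with h | h
    · exact ⟨p, hp, fun v hv => (hconst v hv).trans_le h⟩
    · exact ⟨-p, neg_ne_zero.2 hp, fun v hv => by
        rw [LinearMap.neg_apply, hconst v hv]; linarith⟩

section Selection

variable {T : Type*} [MeasurableSpace T]

theorem Measurable.comp_index {β : Type*} [MeasurableSpace β] {f : ℕ → T → β}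
    (hf : ∀ k, Measurable (f k)) {n : T → ℕ} (hn : Measurable n) :
    Measurable fun t => f (n t) t :=
  (measurable_from_prod_countable_left (f := fun q : T × ℕ => f q.2 q.1) hf).comp
    (measurable_id.prodMk hn)

/-- A bounded sequence of measurable real functions has a measurable random subsequence
converging everywhere to the upper limit. -/
theorem exists_measurable_index_tendsto_limsup {a : ℕ → T → ℝ} (ha : ∀ k, Measurable (a k))
    {C : ℝ} (hC : ∀ k t, |a k t| ≤ C) :
    ∃ n : ℕ → T → ℕ, (∀ j, Measurable (n j)) ∧ (∀ t, Tendsto (fun j => n j t) atTop atTop) ∧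
      ∀ t, Tendsto (fun j => a (n j t) t) atTop (𝓝 (limsup (fun k => a k t) atTop)) := by
  classical
  set σ : T → ℝ := fun t => limsup (fun k => a k t) atTop
  have hσm : Measurable σ := Measurable.limsup ha
  have hbdd : ∀ t, IsBoundedUnder (· ≤ ·) atTop fun k => a k t := fun t =>
    isBoundedUnder_of ⟨C, fun k => (abs_le.1 (hC k t)).2⟩
  have hbdd' : ∀ t, IsBoundedUnder (· ≥ ·) atTop fun k => a k t := fun t =>
    isBoundedUnder_of ⟨-C, fun k => (abs_le.1 (hC k t)).1⟩
  have hex : ∀ (j : ℕ) (t : T), ∃ k, j ≤ k ∧ σ t - 1 / ((j : ℝ) + 1) < a k t := by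
    intro j t
    have hfreq : ∃ᶠ k in atTop, σ t - 1 / ((j : ℝ) + 1) < a k t :=
      frequently_lt_of_lt_limsup (hbdd' t).isCoboundedUnder_le
        (sub_lt_self _ Nat.one_div_pos_of_nat)
    obtain ⟨k, hjk, hk⟩ := (frequently_atTop.1 hfreq) j
    exact ⟨k, hjk, hk⟩
  refine ⟨fun j t => Nat.find (hex j t), fun j => measurable_find (hex j) fun k => ?_, ?_, ?_⟩
  · exact (MeasurableSet.const _).inter
      (measurableSet_lt (hσm.sub_const _) (ha k))
  · exact fun t => tendsto_atTop_mono (fun j => (Nat.find_spec (hex j t)).1) tendsto_id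
  · intro t
    have hn : Tendsto (fun j => Nat.find (hex j t)) atTop atTop :=
      tendsto_atTop_mono (fun j => (Nat.find_spec (hex j t)).1) tendsto_id
    refine tendsto_order.2 ⟨fun b hb => ?_, fun b hb => ?_⟩
    · have hlim : Tendsto (fun j : ℕ => σ t - 1 / ((j : ℝ) + 1)) atTop (𝓝 (σ t)) := by
        simpa using (tendsto_const_nhds (x := σ t)).sub
          (tendsto_one_div_add_atTop_nhds_zero_nat (𝕜 := ℝ))
      filter_upwards [hlim.eventually (lt_mem_nhds hb)] with j hj
      exact hj.trans (Nat.find_spec (hex j t)).2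
    · exact hn.eventually (eventually_lt_of_limsup_lt hb (hbdd t))

variable {ℓ : ℕ}

/-- A bounded sequence of measurable vector-valued functions has a measurable random subsequence
converging everywhere. -/
theorem exists_measurable_index_tendsto {f : ℕ → T → Fin ℓ → ℝ} (hf : ∀ k, Measurable (f k))
    {C : ℝ} (hC : ∀ k t, ‖f k t‖ ≤ C) :
    ∃ n : ℕ → T → ℕ, (∀ j, Measurable (n j)) ∧ (∀ t, Tendsto (fun j => n j t) atTop atTop) ∧
      ∀ t, ∃ x, Tendsto (fun j => f (n j t) t) atTop (𝓝 x) := by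
  classical
  have key : ∀ s : Finset (Fin ℓ), ∃ n : ℕ → T → ℕ, (∀ j, Measurable (n j)) ∧
      (∀ t, Tendsto (fun j => n j t) atTop atTop) ∧
      ∀ t, ∀ i ∈ s, ∃ x, Tendsto (fun j => f (n j t) t i) atTop (𝓝 x) := by
    intro s
    induction s using Finset.induction_on with
    | empty => exact ⟨fun j _ => j, fun j => measurable_const, fun t => tendsto_id, by simp⟩
    | insert i s _ ih =>
      obtain ⟨n, hn, hnt, hlim⟩ := ih
      obtain ⟨m, hm, hmt, hmlim⟩ := exists_measurable_index_tendsto_limsup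
        (a := fun j t => f (n j t) t i) (C := C)
        (fun j => (measurable_pi_apply i).comp (Measurable.comp_index hf (hn j)))
        (fun j t => (norm_le_pi_norm (f (n j t) t) i).trans (hC _ t))
      refine ⟨fun j t => n (m j t) t, fun j => Measurable.comp_index hn (hm j),
        fun t => (hnt t).comp (hmt t), fun t i' hi' => ?_⟩
      rcases Finset.mem_insert.1 hi' with rfl | hi'
      · exact ⟨_, hmlim t⟩
      · obtain ⟨x, hx⟩ := hlim t i' hi'
        exact ⟨x, hx.comp (hmt t)⟩
  obtain ⟨n, hn, hnt, hlim⟩ := key Finset.univ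
  refine ⟨n, hn, hnt, fun t => ?_⟩
  choose x hx using fun i => hlim t i (Finset.mem_univ i)
  exact ⟨x, tendsto_pi_nhds.2 hx⟩

/-- Measurable selection of a cluster point maximizing a linear functional. -/
theorem exists_measurable_mapClusterPt_eq_limsup {f : ℕ → T → Fin ℓ → ℝ}
    (hf : ∀ k, Measurable (f k)) {C : ℝ} (hC : ∀ k t, ‖f k t‖ ≤ C)
    (p : (Fin ℓ → ℝ) →L[ℝ] ℝ) :
    ∃ h : T → Fin ℓ → ℝ, Measurable h ∧ (∀ t, MapClusterPt (h t) atTop fun k => f k t) ∧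
      ∀ t, p (h t) = limsup (fun k => p (f k t)) atTop := by
  obtain ⟨n, hn, hnt, hnlim⟩ := exists_measurable_index_tendsto_limsup
    (a := fun k t => p (f k t)) (C := ‖p‖ * C) (fun k => p.measurable.comp (hf k))
    (fun k t => (p.le_opNorm _).trans (by gcongr; exact hC k t))
  obtain ⟨m, hm, hmt, hmlim⟩ := exists_measurable_index_tendsto
    (fun j => Measurable.comp_index hf (hn j)) (fun j t => hC (n j t) t)
  choose h hh using hmlim
  refine ⟨h, measurable_of_tendsto_metrizable
    (fun j => Measurable.comp_index (fun j => Measurable.comp_index hf (hn j)) (hm j))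
    (tendsto_pi_nhds.2 hh), fun t => ?_, fun t => ?_⟩
  · exact (hh t).mapClusterPt.of_comp ((hnt t).comp (hmt t))
  · exact tendsto_nhds_unique ((p.continuous.tendsto _).comp (hh t)) ((hnlim t).comp (hmt t))

end Selection

section Atoms

variable {T : Type*} [MeasurableSpace T]

/-- Measure-theoretic atoms: sets of nonzero measure that cannot be split into two pieces of
nonzero measure. -/
def IsMeasureAtom (ν : Measure T) (A : Set T) : Prop :=
  MeasurableSet A ∧ ν A ≠ 0 ∧ ∀ B ⊆ A, MeasurableSet B → ν B = 0 ∨ ν (A \ B) = 0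

/-- A measure is diffuse if it has no measure-theoretic atom. -/
def IsDiffuse (ν : Measure T) : Prop := ∀ A, ¬ IsMeasureAtom ν A

theorem IsDiffuse.exists_subset {ν : Measure T} (hν : IsDiffuse ν) {A : Set T}
    (hA : MeasurableSet A) (hA0 : ν A ≠ 0) :
    ∃ B ⊆ A, MeasurableSet B ∧ ν B ≠ 0 ∧ ν (A \ B) ≠ 0 := by
  by_contra! h
  exact hν A ⟨hA, hA0, fun B hBA hB => or_iff_not_imp_left.2 (h B hBA hB)⟩

theorem IsDiffuse.exists_disjoint_family {ν : Measure T} (hν : IsDiffuse ν) (n : ℕ) {A : Set T}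
    (hA : MeasurableSet A) (hA0 : ν A ≠ 0) :
    ∃ P : Fin n → Set T, (∀ i, MeasurableSet (P i)) ∧ (∀ i, P i ⊆ A) ∧ (∀ i, ν (P i) ≠ 0) ∧
      Pairwise fun i j => Disjoint (P i) (P j) := by
  induction n generalizing A with
  | zero => exact ⟨fun _ => ∅, by simp, by simp, fun i => i.elim0, fun i => i.elim0⟩
  | succ n ih =>
    obtain ⟨B, hBA, hB, hB0, hAB0⟩ := hν.exists_subset hA hA0
    obtain ⟨P, hP, hPA, hP0, hdisj⟩ := ih (hA.diff hB) hAB0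
    have hBP : ∀ i, Disjoint B (P i) := fun i => Set.disjoint_sdiff_right.mono_right (hPA i)
    refine ⟨Fin.cons B P, Fin.cases hB hP, Fin.cases hBA fun i => (hPA i).trans Set.sdiff_subset,
      Fin.cases hB0 hP0, fun i j => ?_⟩
    refine Fin.cases (fun h => ?_) (fun i h => ?_) i <;> revert h <;>
      refine Fin.cases (fun h => ?_) (fun j h => ?_) j
    · exact absurd rfl h
    · exact hBP j
    · exact (hBP i).symm
    · exact hdisj fun hij => h (congrArg Fin.succ hij)

/-- The space splits, up to nothing, into countably many atoms and a diffuse part. -/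
theorem exists_countable_atoms_isDiffuse (ν : Measure T) [IsFiniteMeasure ν] :
    ∃ 𝒜 : Set (Set T), 𝒜.Countable ∧ (∀ A ∈ 𝒜, IsMeasureAtom ν A) ∧
      IsDiffuse (ν.restrict (⋃₀ 𝒜)ᶜ) := by
  obtain ⟨𝒜, h𝒜⟩ := zorn_subset
    {𝒜 : Set (Set T) | (∀ A ∈ 𝒜, IsMeasureAtom ν A) ∧ 𝒜.Pairwise Disjoint} (by
      intro c hc hchain
      refine ⟨⋃₀ c, ⟨fun A ⟨s, hs, hA⟩ => (hc hs).1 A hA, ?_⟩, fun s hs =>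
        Set.subset_sUnion_of_mem hs⟩
      exact (Set.pairwise_sUnion hchain.directedOn).2 fun s hs => (hc hs).2)
  obtain ⟨hat, hdisj⟩ := h𝒜.prop
  have hcount : 𝒜.Countable := by
    have := Measure.countable_meas_pos_of_disjoint_iUnion (μ := ν) (As := fun A : 𝒜 => (A : Set T))
      (fun A => (hat A A.2).1)
      (fun A B hAB => hdisj A.2 B.2 (fun h => hAB (Subtype.ext h)))
    have huniv : {A : 𝒜 | 0 < ν (A : Set T)} = Set.univ :=
      Set.eq_univ_of_forall fun A => pos_iff_ne_zero.2 (hat A A.2).2.1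
    rw [huniv, Set.countable_univ_iff] at this
    exact this
  refine ⟨𝒜, hcount, hat, fun A hA => ?_⟩
  have hU : MeasurableSet (⋃₀ 𝒜) := .sUnion hcount fun A h => (hat A h).1
  have hA' : IsMeasureAtom ν (A ∩ (⋃₀ 𝒜)ᶜ) := by
    refine ⟨hA.1.inter hU.compl, ?_, fun B hBA hB => ?_⟩
    · rw [← Measure.restrict_apply hA.1]
      exact hA.2.1
    · have := hA.2.2 B (hBA.trans Set.inter_subset_left) hB
      rw [Measure.restrict_apply hB, Measure.restrict_apply (hA.1.diff hB)] at this
      rwa [Set.inter_eq_left.2 (hBA.trans Set.inter_subset_right),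
        ← Set.inter_sdiff_right_comm] at this
  have hdisjA : ∀ B ∈ 𝒜, Disjoint (A ∩ (⋃₀ 𝒜)ᶜ) B := fun B hB =>
    (disjoint_compl_left.mono_left Set.inter_subset_right).mono_right
      (Set.subset_sUnion_of_mem hB)
  have hmem : A ∩ (⋃₀ 𝒜)ᶜ ∈ 𝒜 := by
    refine h𝒜.le_of_ge (y := insert (A ∩ (⋃₀ 𝒜)ᶜ) 𝒜) ⟨?_, ?_⟩ (Set.subset_insert _ _)
      (Set.mem_insert _ _)
    · rintro B (rfl | hB)
      exacts [hA', hat B hB]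
    · exact hdisj.insert fun B hB _ => ⟨hdisjA B hB, (hdisjA B hB).symm⟩
  exact hA'.2.1 (by rw [disjoint_self.1 (hdisjA _ hmem)]; exact measure_empty)

/-- An integrable real function is almost everywhere constant on an atom. -/
theorem IsMeasureAtom.ae_eq_average {ν : Measure T} [IsFiniteMeasure ν] {A : Set T}
    (hA : IsMeasureAtom ν A) {a : T → ℝ} (ha : Measurable a) (hai : Integrable a ν) :
    ∀ᵐ t ∂ν.restrict A, a t = ⨍ s in A, a s ∂ν := by
  set c := ⨍ s in A, a s ∂ν
  have hc : ∫ t in A, (a t - c) ∂ν = 0 := by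
    exact integral_sub_average (μ := ν.restrict A) a
  have hint : Integrable (fun t => a t - c) (ν.restrict A) :=
    (hai.restrict).sub (integrable_const c)
  have hne : NeZero (ν.restrict A) := ⟨by simpa using hA.2.1⟩
  have hdich : ∀ s : Set T, MeasurableSet s →
      (∀ᵐ t ∂ν.restrict A, t ∉ s) ∨ ∀ᵐ t ∂ν.restrict A, t ∈ s := by
    intro s hs
    have h := hA.2.2 (A ∩ s) Set.inter_subset_left (hA.1.inter hs)
    rw [Set.sdiff_self_inter] at h
    refine h.imp (fun h => ?_) fun h => ?_
    · rw [ae_restrict_iff' hA.1, ae_iff]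
      refine measure_mono_null (fun t ht => ?_) h
      simpa using ht
    · rw [ae_restrict_iff' hA.1, ae_iff]
      refine measure_mono_null (fun t ht => ?_) h
      simpa using ht
  have hfalse : ∀ b : T → ℝ, Integrable b (ν.restrict A) → ∫ t in A, b t ∂ν = 0 →
      (∀ᵐ t ∂ν.restrict A, 0 < b t) → False := by
    intro b hb hb0 hpos
    have h0 := (integral_eq_zero_iff_of_nonneg_ae (hpos.mono fun t ht => ht.le) hb).1 hb0
    obtain ⟨t, ht, ht'⟩ := (hpos.and h0).exists
    exact ht.ne' ht'
  have h1 : ∀ᵐ t ∂ν.restrict A, t ∉ {t | c < a t} := by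
    refine (hdich _ (measurableSet_lt measurable_const ha)).resolve_right fun h => ?_
    exact hfalse _ hint hc (h.mono fun t ht => sub_pos.2 ht)
  have h2 : ∀ᵐ t ∂ν.restrict A, t ∉ {t | a t < c} := by
    refine (hdich _ (measurableSet_lt ha measurable_const)).resolve_right fun h => ?_
    refine hfalse (fun t => -(a t - c)) hint.neg (by rw [integral_neg, hc, neg_zero])
      (h.mono fun t ht => by simpa using ht)
  filter_upwards [h1, h2] with t ht1 ht2
  exact le_antisymm (not_lt.1 ht1) (not_lt.1 ht2)

end Atoms

/-- A nonempty bounded closed convex subset of a real Hilbert space has an extreme point. -/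
theorem Convex.exists_extreme_of_isClosed_of_isBounded {H : Type*} [NormedAddCommGroup H]
    [InnerProductSpace ℝ H] [CompleteSpace H] {S : Set H} (hconv : Convex ℝ S)
    (hclosed : IsClosed S) (hbdd : Bornology.IsBounded S) (hne : S.Nonempty) :
    ∃ w ∈ S, ∀ d, w + d ∈ S → w - d ∈ S → d = 0 := by
  let D := InnerProductSpace.toDual ℝ H
  let S' : Set (WeakDual ℝ H) := {φ | D.symm (WeakDual.toStrongDual φ) ∈ S}
  have happ : ∀ (φ : WeakDual ℝ H) (v : H),
      inner ℝ (D.symm (WeakDual.toStrongDual φ)) v = φ v := fun φ v =>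
    InnerProductSpace.toDual_symm_apply
  have hS'closed : IsClosed S' := by
    refine ⟨isOpen_iff_mem_nhds.2 fun φ hφ => ?_⟩
    obtain ⟨f, u, hfS, hfu⟩ := geometric_hahn_banach_closed_point hconv hclosed hφ
    have hf : ∀ ψ : WeakDual ℝ H, f (D.symm (WeakDual.toStrongDual ψ)) = ψ (D.symm f) := by
      intro ψ
      rw [← happ ψ, real_inner_comm]
      exact (InnerProductSpace.toDual_symm_apply).symm
    have hopen : IsOpen {ψ : WeakDual ℝ H | u < ψ (D.symm f)} :=
      isOpen_lt continuous_const (WeakDual.eval_continuous _)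
    refine mem_of_superset (hopen.mem_nhds ?_) fun ψ hψ hψS => ?_
    · rw [Set.mem_ofPred_eq, ← hf]
      exact hfu
    · rw [Set.mem_ofPred_eq, ← hf] at hψ
      exact (hfS _ hψS).not_gt hψ
  have hS'bdd : Bornology.IsBounded S' := by
    refine (WeakDual.isBounded_toStrongDual_preimage_iff_isBounded.2
      (D.lipschitz.isBounded_image hbdd)).subset fun φ hφ => ?_
    exact ⟨_, hφ, D.apply_symm_apply _⟩
  have hS'ne : S'.Nonempty := by
    obtain ⟨w, hw⟩ := hne
    refine ⟨StrongDual.toWeakDual (D w), ?_⟩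
    change D.symm (D w) ∈ S
    rwa [LinearIsometryEquiv.symm_apply_apply]
  have : LocallyConvexSpace ℝ (WeakDual ℝ H) :=
    inferInstanceAs (LocallyConvexSpace ℝ (WeakBilin (topDualPairing ℝ H)))
  obtain ⟨φ, hφ⟩ :=
    (WeakDual.isCompact_of_bounded_of_closed hS'bdd hS'closed).extremePoints_nonempty hS'ne
  refine ⟨_, hφ.1, fun d hd hd' => ?_⟩
  let δ : WeakDual ℝ H := StrongDual.toWeakDual (D d)
  have hδ : D.symm (WeakDual.toStrongDual δ) = d := D.symm_apply_apply d
  have h1 : φ + δ ∈ S' := by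
    change D.symm (WeakDual.toStrongDual (φ + δ)) ∈ S
    rwa [map_add, map_add, hδ]
  have h2 : φ - δ ∈ S' := by
    change D.symm (WeakDual.toStrongDual (φ - δ)) ∈ S
    rwa [map_sub, map_sub, hδ]
  have h3 : φ + δ = φ := hφ.2 h1 h2 ⟨1 / 2, 1 / 2, by norm_num, by norm_num, by norm_num, by
    module⟩
  rw [← hδ, add_eq_left.1 h3, map_zero, map_zero]

/-- **Lyapunov's convexity theorem** for a bounded vector density. -/
theorem IsDiffuse.exists_setIntegral_eq_smul {T : Type*} [MeasurableSpace T] {ν : Measure T}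
    [IsFiniteMeasure ν] (hν : IsDiffuse ν) {ℓ : ℕ} {h : T → Fin ℓ → ℝ} (hh : Measurable h) {C : ℝ}
    (hC : ∀ t, ‖h t‖ ≤ C) {c : ℝ} (hc0 : 0 ≤ c) (hc1 : c ≤ 1) :
    ∃ B, MeasurableSet B ∧ ∫ t in B, h t ∂ν = c • ∫ t, h t ∂ν := by
  classical
  have hhi : ∀ i, Measurable fun t => h t i := fun i => (measurable_pi_apply i).comp hh
  have hhC : ∀ i t, ‖h t i‖ ≤ C := fun i t => (norm_le_pi_norm (h t) i).trans (hC t)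
  have hint : Integrable h ν := .of_bound hh.aestronglyMeasurable C (.of_forall hC)
  have hmem : ∀ i, MemLp (fun t => h t i) 2 ν := fun i =>
    .of_bound (hhi i).aestronglyMeasurable C (.of_forall (hhC i))
  have hinner : ∀ i (w : Lp ℝ 2 ν), inner ℝ ((hmem i).toLp _) w = ∫ t, w t * h t i ∂ν := by
    intro i w
    rw [L2.inner_def]
    refine integral_congr_ae ?_
    filter_upwards [(hmem i).coeFn_toLp] with t ht
    rw [ht]
    rfl
  let one : Lp ℝ 2 ν := (memLp_const (1 : ℝ)).toLp _
  have hone : one =ᵐ[ν] fun _ => (1 : ℝ) := MemLp.coeFn_toLp _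
  have hIcc : ∀ w : Lp ℝ 2 ν, w ∈ Set.Icc 0 one ↔ ∀ᵐ t ∂ν, 0 ≤ w t ∧ w t ≤ 1 := by
    intro w
    rw [Set.mem_Icc, ← Lp.coeFn_le, ← Lp.coeFn_le, eventually_and]
    refine and_congr ⟨fun H => ?_, fun H => ?_⟩ ⟨fun H => ?_, fun H => ?_⟩
    · filter_upwards [H, Lp.coeFn_zero ℝ 2 ν] with t h1 h2
      exact h2.symm.trans_le h1
    · filter_upwards [H, Lp.coeFn_zero ℝ 2 ν] with t h1 h2
      exact h2.trans_le h1
    · filter_upwards [H, hone] with t h1 h2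
      exact h1.trans_eq h2
    · filter_upwards [H, hone] with t h1 h2
      exact h1.trans_eq h2.symm
  let S : Set (Lp ℝ 2 ν) :=
    Set.Icc 0 one ∩ {w | ∀ i, inner ℝ ((hmem i).toLp _) w = c * ∫ t, h t i ∂ν}
  have hSconv : Convex ℝ S := by
    refine Convex.inter (fun x hx y hy a b ha hb hab => ?_) fun x hx y hy a b _ _ hab i => ?_
    · rw [hIcc] at hx hy ⊢
      filter_upwards [hx, hy, Lp.coeFn_add (a • x) (b • y), Lp.coeFn_smul a x,
        Lp.coeFn_smul b y] with t h1 h2 h3 h4 h5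
      rw [h3, Pi.add_apply, h4, h5]
      exact convex_Icc (0 : ℝ) 1 h1 h2 ha hb hab
    · rw [inner_add_right, inner_smul_right, inner_smul_right, hx i, hy i, ← add_mul, hab, one_mul]
  have hSclosed : IsClosed S := by
    refine isClosed_Icc.inter ?_
    rw [Set.ofPred_forall]
    exact isClosed_iInter fun i => isClosed_eq (by fun_prop) continuous_const
  have hSbdd : Bornology.IsBounded S := by
    refine isBounded_iff_forall_norm_le.2 ⟨‖one‖, fun w hw => ?_⟩
    refine norm_le_norm_of_abs_le_abs ?_
    rw [abs_of_nonneg hw.1.1, abs_of_nonneg (hw.1.1.trans hw.1.2)]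
    exact hw.1.2
  have hSne : S.Nonempty := by
    have hcone : (c • one : Lp ℝ 2 ν) =ᵐ[ν] fun _ => c := by
      filter_upwards [Lp.coeFn_smul c one, hone] with t h1 h2
      rw [h1, Pi.smul_apply, h2, smul_eq_mul, mul_one]
    refine ⟨c • one, (hIcc _).2 (hcone.mono fun t ht => by rw [ht]; exact ⟨hc0, hc1⟩), fun i => ?_⟩
    rw [hinner, ← integral_const_mul]
    exact integral_congr_ae (hcone.mono fun t ht => by simp only [ht])
  obtain ⟨w, hwS, hext⟩ := hSconv.exists_extreme_of_isClosed_of_isBounded hSclosed hSbdd hSne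
  have hwm : Measurable w := (Lp.stronglyMeasurable w).measurable
  have hw01 := (hIcc w).1 hwS.1
  have hnull : ∀ ε : ℝ, 0 < ε → ν {t | ε ≤ w t ∧ w t ≤ 1 - ε} = 0 := by
    intro ε hε
    by_contra hpos
    have hAm : MeasurableSet {t | ε ≤ w t ∧ w t ≤ 1 - ε} :=
      (measurableSet_le measurable_const hwm).inter (measurableSet_le hwm measurable_const)
    obtain ⟨P, hPm, hPA, hP0, hdisj⟩ := hν.exists_disjoint_family (ℓ + 1) hAm hpos
    obtain ⟨b, hbker, hb0⟩ := (Submodule.ne_bot_iff _).1 <| LinearMap.ker_ne_bot_of_finrank_lt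
      (f := Fintype.linearCombination ℝ fun i => ∫ t in P i, h t ∂ν) (by simp)
    set a : Fin (ℓ + 1) → ℝ := (ε / ‖b‖) • b with ha
    have hbn : 0 < ‖b‖ := norm_pos_iff.2 hb0
    have hane : a ≠ 0 := smul_ne_zero (div_pos hε hbn).ne' hb0
    have haε : ∀ i, |a i| ≤ ε := by
      intro i
      refine (norm_le_pi_norm a i).trans ?_
      rw [ha, norm_smul, Real.norm_of_nonneg (div_pos hε hbn).le, div_mul_cancel₀ _ hbn.ne']
    have hasum : ∑ i, a i • ∫ t in P i, h t ∂ν = 0 := by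
      have : Fintype.linearCombination ℝ (fun i => ∫ t in P i, h t ∂ν) a = 0 := by
        rw [ha, map_smul, LinearMap.mem_ker.1 hbker, smul_zero]
      rwa [Fintype.linearCombination_apply] at this
    let D : T → ℝ := fun t => ∑ i, (P i).indicator (fun _ => a i) t
    have hDm : Measurable D :=
      Finset.measurable_sum _ fun i _ => measurable_const.indicator (hPm i)
    have hDP : ∀ i, ∀ t ∈ P i, D t = a i := by
      intro i t ht
      refine (Finset.sum_eq_single i (fun j _ hj => Set.indicator_of_notMem (fun htj => ?_) _)
        (fun hi => absurd (Finset.mem_univ i) hi)).trans (Set.indicator_of_mem ht _)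
      exact Set.disjoint_left.1 (hdisj hj) htj ht
    have hD0 : ∀ t, (∀ i, t ∉ P i) → D t = 0 := fun t ht =>
      Finset.sum_eq_zero fun i _ => Set.indicator_of_notMem (ht i) _
    have hDw : ∀ t, 0 ≤ w t ∧ w t ≤ 1 → |D t| ≤ w t ∧ |D t| ≤ 1 - w t := by
      intro t ht
      by_cases hP : ∃ i, t ∈ P i
      · obtain ⟨i, hi⟩ := hP
        have h1 := hPA i hi
        rw [hDP i t hi]
        exact ⟨(haε i).trans h1.1, (haε i).trans (by linarith [h1.2])⟩
      · rw [hD0 t (not_exists.1 hP), abs_zero]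
        exact ⟨ht.1, sub_nonneg.2 ht.2⟩
    have hDbd : ∀ t, ‖D t‖ ≤ ∑ i, ‖a i‖ := fun t =>
      (norm_sum_le _ _).trans (Finset.sum_le_sum fun i _ => norm_indicator_le_norm_self _ _)
    have hDmem : MemLp D 2 ν := .of_bound hDm.aestronglyMeasurable _ (.of_forall hDbd)
    have hDinner : ∀ i, inner ℝ ((hmem i).toLp _) (hDmem.toLp D) = 0 := by
      intro i
      rw [hinner]
      calc ∫ t, (hDmem.toLp D) t * h t i ∂ν
          = ∫ t, ∑ j, (P j).indicator (fun t => a j * h t i) t ∂ν := by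
            refine integral_congr_ae (hDmem.coeFn_toLp.mono fun t ht => ?_)
            simp only [ht, D, Finset.sum_mul]
            refine Finset.sum_congr rfl fun j _ => ?_
            by_cases htj : t ∈ P j <;> simp [htj]
        _ = ∑ j, a j * ∫ t in P j, h t i ∂ν := by
            rw [integral_finsetSum]
            · refine Finset.sum_congr rfl fun j _ => ?_
              rw [integral_indicator (hPm j), integral_const_mul]
            · exact fun j _ => ((hint.eval i).const_mul _).indicator (hPm j)
        _ = (∑ j, a j • ∫ t in P j, h t ∂ν) i := by
            rw [Finset.sum_apply]
            refine Finset.sum_congr rfl fun j _ => ?_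
            rw [Pi.smul_apply, smul_eq_mul, eval_integral fun i => (hint.eval i).restrict]
        _ = 0 := by rw [hasum]; rfl
    have hd0 : hDmem.toLp D = 0 := by
      refine hext _ ⟨(hIcc _).2 ?_, fun i => ?_⟩ ⟨(hIcc _).2 ?_, fun i => ?_⟩
      · filter_upwards [hw01, hDmem.coeFn_toLp, Lp.coeFn_add w (hDmem.toLp D)] with t h1 h2 h3
        rw [h3, Pi.add_apply, h2]
        have h4 := hDw t h1
        exact ⟨by linarith [neg_abs_le (D t)], by linarith [le_abs_self (D t)]⟩
      · rw [inner_add_right, hDinner, add_zero, hwS.2 i]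
      · filter_upwards [hw01, hDmem.coeFn_toLp, Lp.coeFn_sub w (hDmem.toLp D)] with t h1 h2 h3
        rw [h3, Pi.sub_apply, h2]
        have h4 := hDw t h1
        exact ⟨by linarith [le_abs_self (D t)], by linarith [neg_abs_le (D t)]⟩
      · rw [inner_sub_right, hDinner, sub_zero, hwS.2 i]
    have hDae : ∀ᵐ t ∂ν, D t = 0 := by
      filter_upwards [hDmem.coeFn_toLp, Lp.coeFn_zero ℝ 2 ν] with t h1 h2
      rw [← h1, hd0, h2, Pi.zero_apply]
    refine hane (funext fun i => by_contra fun hai => hP0 i ?_)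
    exact measure_mono_null (fun t ht h0 => hai ((hDP i t ht).symm.trans h0)) hDae
  have hdich : ∀ᵐ t ∂ν, w t = 0 ∨ w t = 1 := by
    have hall : ∀ᵐ t ∂ν, ∀ n : ℕ, ¬ (1 / ((n : ℝ) + 1) ≤ w t ∧ w t ≤ 1 - 1 / ((n : ℝ) + 1)) :=
      ae_all_iff.2 fun n => by
        simpa [ae_iff] using hnull (1 / ((n : ℝ) + 1)) Nat.one_div_pos_of_nat
    filter_upwards [hw01, hall] with t h1 h2
    by_contra! hne
    obtain ⟨n, hn⟩ := exists_nat_one_div_lt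
      (lt_min (lt_of_le_of_ne h1.1 hne.1.symm) (sub_pos.2 (lt_of_le_of_ne h1.2 hne.2)))
    have h3 := lt_min_iff.1 hn
    exact h2 n ⟨h3.1.le, by linarith [h3.2]⟩
  have hBm : MeasurableSet {t | w t = 1} := hwm (measurableSet_singleton 1)
  refine ⟨{t | w t = 1}, hBm, funext fun i => ?_⟩
  rw [Pi.smul_apply, smul_eq_mul, eval_integral fun i => (hint.eval i).restrict,
    eval_integral fun i => hint.eval i, ← hwS.2 i, hinner, ← integral_indicator hBm]
  refine integral_congr_ae (hdich.mono fun t ht => ?_)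
  rcases ht with ht | ht <;> simp [Set.indicator, ht]

section Fatou

variable {T : Type*} [MeasurableSpace T] {ν : Measure T} [IsFiniteMeasure ν]

/-- Equality in the reverse Fatou inequality forces almost everywhere convergence to the upper
limit along a subsequence. -/
theorem exists_subseq_tendsto_limsup_of_integral_le {a : ℕ → T → ℝ} (ha : ∀ k, Measurable (a k))
    {C : ℝ} (hC : ∀ k t, |a k t| ≤ C) {c : ℝ}
    (hc : Tendsto (fun k => ∫ t, a k t ∂ν) atTop (𝓝 c))
    (hle : ∫ t, limsup (fun k => a k t) atTop ∂ν ≤ c) :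
    ∃ ψ : ℕ → ℕ, StrictMono ψ ∧ ∀ᵐ t ∂ν,
      Tendsto (fun k => a (ψ k) t) atTop (𝓝 (limsup (fun k => a k t) atTop)) := by
  set σ : T → ℝ := fun t => limsup (fun k => a k t) atTop
  have hσm : Measurable σ := Measurable.limsup ha
  obtain ⟨n, -, -, hn⟩ := exists_measurable_index_tendsto_limsup ha hC
  have hσC : ∀ t, |σ t| ≤ C := fun t =>
    le_of_tendsto (hn t).abs (.of_forall fun j => hC _ t)
  have hσi : Integrable σ ν := .of_bound hσm.aestronglyMeasurable C (.of_forall hσC)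
  have hai : ∀ k, Integrable (a k) ν := fun k =>
    .of_bound (ha k).aestronglyMeasurable C (.of_forall (hC k))
  have hpos : Tendsto (fun k => ∫ t, max (a k t - σ t) 0 ∂ν) atTop (𝓝 0) := by
    suffices h : Tendsto (fun k => ∫ t, max (a k t - σ t) 0 ∂ν) atTop
        (𝓝 (∫ _, (0 : ℝ) ∂ν)) by simpa using h
    refine tendsto_integral_of_dominated_convergence (fun _ => C + C)
      (fun k => (((ha k).sub hσm).max measurable_const).aestronglyMeasurable)
      (integrable_const _) (fun k => .of_forall fun t => ?_) (.of_forall fun t => ?_)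
    · rw [Real.norm_of_nonneg (le_max_right _ _)]
      have h1 := abs_le.1 (hC k t)
      have h2 := abs_le.1 (hσC t)
      exact max_le (by linarith) (by linarith)
    · refine tendsto_order.2 ⟨fun b hb => .of_forall fun k => hb.trans_le (le_max_right _ _),
        fun b hb => ?_⟩
      filter_upwards [eventually_lt_of_limsup_lt (lt_add_of_pos_right (σ t) hb)
        (isBoundedUnder_of ⟨C, fun k => (abs_le.1 (hC k t)).2⟩)] with k hk
      exact max_lt (by linarith) hb
  have hL1 : Tendsto (fun k => ∫ t, ‖a k t - σ t‖ ∂ν) atTop (𝓝 0) := by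
    have hup : Tendsto (fun k => (c - ∫ t, a k t ∂ν) + 2 * ∫ t, max (a k t - σ t) 0 ∂ν)
        atTop (𝓝 0) := by
      simpa using (hc.const_sub c).add (hpos.const_mul 2)
    refine squeeze_zero (fun k => integral_nonneg fun t => norm_nonneg _) (fun k => ?_) hup
    have hmi : Integrable (fun t => max (a k t - σ t) 0) ν := ((hai k).sub hσi).pos_part
    have hdi : Integrable (fun t => σ t - a k t) ν := hσi.sub (hai k)
    have heq : ∫ t, ‖a k t - σ t‖ ∂ν
        = (∫ t, σ t ∂ν - ∫ t, a k t ∂ν) + 2 * ∫ t, max (a k t - σ t) 0 ∂ν := by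
      rw [← integral_sub hσi (hai k), ← integral_const_mul,
        ← integral_add hdi (hmi.const_mul 2)]
      refine integral_congr_ae (.of_forall fun t => ?_)
      simp only [Real.norm_eq_abs]
      rcases le_total (a k t - σ t) 0 with h | h
      · rw [abs_of_nonpos h, max_eq_right h]; ring
      · rw [abs_of_nonneg h, max_eq_left h]; ring
    rw [heq]
    gcongr
  refine (tendstoInMeasure_of_tendsto_eLpNorm (p := 1) one_ne_zero
    (fun k => (ha k).aestronglyMeasurable) hσm.aestronglyMeasurable ?_).exists_seq_tendsto_ae
  have := ENNReal.tendsto_ofReal hL1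
  rw [ENNReal.ofReal_zero] at this
  refine this.congr fun k => ?_
  rw [eLpNorm_one_eq_lintegral_enorm]
  exact ofReal_integral_norm_eq_lintegral_enorm ((hai k).sub hσi)

variable {ℓ : ℕ}

/-- Along a subsequence, a bounded sequence of measurable functions converges almost everywhere
outside a set on which the measure is diffuse. -/
theorem exists_subseq_tendsto_off_diffuse {f : ℕ → T → Fin ℓ → ℝ} (hf : ∀ k, Measurable (f k))
    {C : ℝ} (hC : ∀ k t, ‖f k t‖ ≤ C) :
    ∃ φ : ℕ → ℕ, StrictMono φ ∧ ∃ N, MeasurableSet N ∧ IsDiffuse (ν.restrict N) ∧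
      ∀ᵐ t ∂ν, t ∉ N → ∃ y, Tendsto (fun k => f (φ k) t) atTop (𝓝 y) := by
  obtain ⟨𝒜, hcount, hat, hdiff⟩ := exists_countable_atoms_isDiffuse ν
  have : Countable 𝒜 := hcount
  have hfi : ∀ k i, Integrable (fun t => f k t i) ν := fun k i =>
    .of_bound ((measurable_pi_apply i).comp (hf k)).aestronglyMeasurable C
      (.of_forall fun t => (norm_le_pi_norm _ i).trans (hC k t))
  have hconst : ∀ A ∈ 𝒜, ∀ k, ∀ᵐ t ∂ν.restrict A,
      f k t = fun i => ⨍ s in A, f k s i ∂ν := by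
    intro A hA k
    filter_upwards [ae_all_iff.2 fun i => (hat A hA).ae_eq_average
      ((measurable_pi_apply i).comp (hf k)) (hfi k i)] with t ht
    exact funext ht
  let b : ℕ → 𝒜 → Fin ℓ → ℝ := fun k A i => ⨍ s in (A : Set T), f k s i ∂ν
  have hb : ∀ k, b k ∈ Set.univ.pi fun _ : 𝒜 => Metric.closedBall (0 : Fin ℓ → ℝ) C := by
    intro k A _
    have : NeZero (ν.restrict (A : Set T)) := ⟨by simpa using (hat A A.2).2.1⟩
    obtain ⟨t, ht⟩ := (hconst A A.2 k).exists
    rw [mem_closedBall_zero_iff]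
    exact (congrArg norm ht).symm.trans_le (hC k t)
  obtain ⟨z, -, φ, hφ, hz⟩ :=
    (isCompact_univ_pi fun _ : 𝒜 => isCompact_closedBall (0 : Fin ℓ → ℝ) C).tendsto_subseq hb
  refine ⟨φ, hφ, (⋃₀ 𝒜)ᶜ, (MeasurableSet.sUnion hcount fun A h => (hat A h).1).compl, hdiff, ?_⟩
  have hall : ∀ᵐ t ∂ν, ∀ A : 𝒜, ∀ k, t ∈ (A : Set T) → f k t = b k A :=
    ae_all_iff.2 fun A => ae_all_iff.2 fun k =>
      (ae_restrict_iff' (hat A A.2).1).1 (hconst A A.2 k)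
  filter_upwards [hall] with t ht htN
  obtain ⟨A, hA, htA⟩ := Set.notMem_compl_iff.1 htN
  refine ⟨z ⟨A, hA⟩, (tendsto_pi_nhds.1 hz ⟨A, hA⟩).congr fun k => ?_⟩
  exact (ht ⟨A, hA⟩ (φ k) htA).symm

/-- The integrals of the measurable selections of the cluster points of a sequence. -/
def clusterIntegral (ν : Measure T) (f : ℕ → T → Fin ℓ → ℝ) : Set (Fin ℓ → ℝ) :=
  {y | ∃ h : T → Fin ℓ → ℝ, Measurable h ∧ (∀ t, MapClusterPt (h t) atTop fun k => f k t) ∧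
    ∫ t, h t ∂ν = y}

theorem MapClusterPt.norm_le {E : Type*} [SeminormedAddCommGroup E] {u : ℕ → E} {y : E} {C : ℝ}
    (hy : MapClusterPt y atTop u) (hC : ∀ k, ‖u k‖ ≤ C) : ‖y‖ ≤ C := by
  have := isClosed_iff_clusterPt.1 (Metric.isClosed_closedBall (x := (0 : E)) (ε := C)) y
    (hy.clusterPt.mono (le_principal_iff.2 (mem_map.2 (univ_mem' fun k =>
      mem_closedBall_zero_iff.2 (hC k)))))
  exact mem_closedBall_zero_iff.1 this

theorem MapClusterPt.eq_of_tendsto {X : Type*} [TopologicalSpace X] [T2Space X] {u : ℕ → X}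
    {y z : X} (hy : MapClusterPt y atTop u) (hz : Tendsto u atTop (𝓝 z)) : y = z := by
  have : NeBot (𝓝 y ⊓ 𝓝 z) := NeBot.mono hy.clusterPt.neBot (inf_le_inf_left _ hz)
  exact eq_of_nhds_neBot this

theorem convex_clusterIntegral {f : ℕ → T → Fin ℓ → ℝ} {C : ℝ} (hC : ∀ k t, ‖f k t‖ ≤ C)
    {N : Set T} (hN : MeasurableSet N) (hdiff : IsDiffuse (ν.restrict N))
    (hlim : ∀ᵐ t ∂ν, t ∉ N → ∃ y, Tendsto (fun k => f k t) atTop (𝓝 y)) :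
    Convex ℝ (clusterIntegral ν f) := by
  classical
  rintro _ ⟨h₁, hm₁, hc₁, rfl⟩ _ ⟨h₂, hm₂, hc₂, rfl⟩ a b ha hb hab
  have hb₁ : ∀ t, ‖h₁ t‖ ≤ C := fun t => (hc₁ t).norm_le fun k => hC k t
  have hb₂ : ∀ t, ‖h₂ t‖ ≤ C := fun t => (hc₂ t).norm_le fun k => hC k t
  have hi₁ : Integrable h₁ ν := .of_bound hm₁.aestronglyMeasurable C (.of_forall hb₁)
  have hi₂ : Integrable h₂ ν := .of_bound hm₂.aestronglyMeasurable C (.of_forall hb₂)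
  obtain ⟨B, hB, hBint⟩ := hdiff.exists_setIntegral_eq_smul (hm₁.sub hm₂) (C := C + C)
    (fun t => (norm_sub_le _ _).trans (add_le_add (hb₁ t) (hb₂ t))) ha (by linarith : a ≤ 1)
  rw [Measure.restrict_restrict hB] at hBint
  have hNint : ∫ t in N, (h₁ - h₂) t ∂ν = ∫ t, (h₁ - h₂) t ∂ν := by
    refine setIntegral_eq_integral_of_ae_compl_eq_zero (hlim.mono fun t ht htN => ?_)
    obtain ⟨y, hy⟩ := ht htN
    rw [Pi.sub_apply, (hc₁ t).eq_of_tendsto hy, (hc₂ t).eq_of_tendsto hy, sub_self]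
  refine ⟨fun t => h₂ t + (B ∩ N).indicator (h₁ - h₂) t,
    hm₂.add ((hm₁.sub hm₂).indicator (hB.inter hN)), fun t => ?_, ?_⟩
  · by_cases ht : t ∈ B ∩ N
    · simpa [Set.indicator_of_mem ht] using hc₁ t
    · simpa [Set.indicator_of_notMem ht] using hc₂ t
  · rw [integral_add hi₂ ((hi₁.sub hi₂).indicator (hB.inter hN)),
      integral_indicator (hB.inter hN), hBint, hNint, integral_sub' hi₁ hi₂,
      ← sub_eq_of_eq_add' hab.symm]
    module

/-- The limit of the integrals of a bounded sequence is the integral of a selection of its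
cluster points. -/
theorem mem_clusterIntegral_of_tendsto {f : ℕ → T → Fin ℓ → ℝ} (hf : ∀ k, Measurable (f k))
    {C : ℝ} (hC : ∀ k t, ‖f k t‖ ≤ C) {x : Fin ℓ → ℝ}
    (hx : Tendsto (fun k => ∫ t, f k t ∂ν) atTop (𝓝 x)) : x ∈ clusterIntegral ν f := by
  obtain ⟨φ, hφ, N, hN, hdiff, hlim⟩ := exists_subseq_tendsto_off_diffuse (ν := ν) hf hC
  let 𝒲 : Set (Submodule ℝ ((Fin ℓ → ℝ) →ₗ[ℝ] ℝ)) :=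
    {W | ∃ ψ : ℕ → ℕ, StrictMono ψ ∧
      ∀ p ∈ W, ∀ᵐ t ∂ν, ∃ y, Tendsto (fun k => p (f (φ (ψ k)) t)) atTop (𝓝 y)}
  have h𝒲 : 𝒲.Nonempty := ⟨⊥, id, strictMono_id, fun p hp => .of_forall fun t => ⟨0, by
    rw [(Submodule.mem_bot ℝ).1 hp]; exact tendsto_const_nhds⟩⟩
  obtain ⟨W, ⟨ψ, hψ, hW⟩, hmax⟩ := wellFounded_gt.has_min 𝒲 h𝒲
  set u : ℕ → T → Fin ℓ → ℝ := fun k => f (φ (ψ k))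
  have hum : ∀ k, Measurable (u k) := fun k => hf _
  have huC : ∀ k t, ‖u k t‖ ≤ C := fun k => hC _
  have hui : ∀ k, Integrable (u k) ν := fun k =>
    .of_bound (hum k).aestronglyMeasurable C (.of_forall (huC k))
  have hux : Tendsto (fun k => ∫ t, u k t ∂ν) atTop (𝓝 x) :=
    hx.comp (hφ.comp hψ).tendsto_atTop
  have hconv : Convex ℝ (clusterIntegral ν u) :=
    convex_clusterIntegral huC hN hdiff (hlim.mono fun t ht htN =>
      (ht htN).imp fun y hy => hy.comp hψ.tendsto_atTop)
  suffices hxu : x ∈ clusterIntegral ν u by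
    obtain ⟨h, hm, hc, hint⟩ := hxu
    exact ⟨h, hm, fun t => (hc t).of_comp (hφ.comp hψ).tendsto_atTop, hint⟩
  by_contra hxu
  have hpint : ∀ (p : (Fin ℓ → ℝ) →ₗ[ℝ] ℝ) {h : T → Fin ℓ → ℝ}, Integrable h ν →
      ∫ t, p (h t) ∂ν = p (∫ t, h t ∂ν) := fun p h hh =>
    p.toContinuousLinearMap.integral_comp_comm hh
  have hpC : ∀ (p : (Fin ℓ → ℝ) →ₗ[ℝ] ℝ) k t,
      |p (u k t)| ≤ ‖p.toContinuousLinearMap‖ * C := fun p k t =>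
    (p.toContinuousLinearMap.le_opNorm _).trans (by gcongr; exact huC k t)
  have hpm : ∀ (p : (Fin ℓ → ℝ) →ₗ[ℝ] ℝ) k, Measurable fun t => p (u k t) := fun p k =>
    p.toContinuousLinearMap.measurable.comp (hum k)
  have hpx : ∀ p : (Fin ℓ → ℝ) →ₗ[ℝ] ℝ,
      Tendsto (fun k => ∫ t, p (u k t) ∂ν) atTop (𝓝 (p x)) := by
    intro p
    simp_rw [hpint p (hui _)]
    exact (p.toContinuousLinearMap.continuous.tendsto x).comp hux
  have hint : ∀ {h : T → Fin ℓ → ℝ}, Measurable h →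
      (∀ t, MapClusterPt (h t) atTop fun k => u k t) → Integrable h ν := fun hm hc =>
    .of_bound hm.aestronglyMeasurable C (.of_forall fun t => (hc t).norm_le fun k => huC k t)
  have hWx : ∀ y ∈ clusterIntegral ν u, ∀ p ∈ W, p y = p x := by
    rintro _ ⟨h, hm, hc, rfl⟩ p hp
    rw [← hpint p (hint hm hc)]
    refine tendsto_nhds_unique ?_ (hpx p)
    refine tendsto_integral_of_dominated_convergence (fun _ => ‖p.toContinuousLinearMap‖ * C)
      (fun k => (hpm p k).aestronglyMeasurable) (integrable_const _)
      (fun k => .of_forall (hpC p k)) ((hW p hp).mono fun t ht => ?_)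
    obtain ⟨y, hy⟩ := ht
    have hcl : MapClusterPt (p (h t)) atTop fun k => p (u k t) :=
      (hc t).continuousAt_comp p.toContinuousLinearMap.continuous.continuousAt
    rwa [hcl.eq_of_tendsto hy]
  let K : Set W.dualCoannihilator := {v | x + (v : Fin ℓ → ℝ) ∈ clusterIntegral ν u}
  have hKmem : ∀ y (hy : y ∈ clusterIntegral ν u), y - x ∈ W.dualCoannihilator := fun y hy =>
    (Submodule.mem_dualCoannihilator _).2 fun p hp => by
      rw [map_sub, hWx y hy p hp, sub_self]
  have hKconv : Convex ℝ K := by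
    intro v hv v' hv' a b ha hb hab
    have := hconv hv hv' ha hb hab
    have heq : a • (x + (v : Fin ℓ → ℝ)) + b • (x + (v' : Fin ℓ → ℝ))
        = x + ((a • v + b • v' : W.dualCoannihilator) : Fin ℓ → ℝ) := by
      rw [smul_add, smul_add, add_add_add_comm, ← add_smul, hab, one_smul]
      rfl
    rwa [heq] at this
  have hKne : K.Nonempty := by
    obtain ⟨h, hm, hc, -⟩ := exists_measurable_mapClusterPt_eq_limsup hum huC 0
    have hy : ∫ t, h t ∂ν ∈ clusterIntegral ν u := ⟨h, hm, hc, rfl⟩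
    refine ⟨⟨_, hKmem _ hy⟩, ?_⟩
    change x + (∫ t, h t ∂ν - x) ∈ clusterIntegral ν u
    rwa [add_sub_cancel]
  have hK0 : (0 : W.dualCoannihilator) ∉ K := by
    change x + 0 ∉ clusterIntegral ν u
    rwa [add_zero]
  obtain ⟨p, hp0, hpK⟩ := hKconv.exists_ne_zero_forall_nonpos hKne hK0
  obtain ⟨q, hq⟩ := LinearMap.exists_extend p
  have hqW : q ∉ W := by
    intro hqW
    refine hp0 (LinearMap.ext fun v => ?_)
    rw [← hq]
    exact (Submodule.mem_dualCoannihilator _).1 v.2 q hqW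
  have hqx : ∀ y ∈ clusterIntegral ν u, q y ≤ q x := by
    intro y hy
    have hy' : (⟨y - x, hKmem y hy⟩ : W.dualCoannihilator) ∈ K := by
      change x + (y - x) ∈ clusterIntegral ν u
      rwa [add_sub_cancel]
    have := hpK _ hy'
    rw [← hq] at this
    change q (y - x) ≤ 0 at this
    rwa [map_sub, sub_nonpos] at this
  obtain ⟨h, hm, hc, hmaxq⟩ :=
    exists_measurable_mapClusterPt_eq_limsup hum huC q.toContinuousLinearMap
  have hσ : ∫ t, limsup (fun k => q (u k t)) atTop ∂ν ≤ q x := by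
    have : ∫ t, limsup (fun k => q (u k t)) atTop ∂ν = q (∫ t, h t ∂ν) := by
      rw [← hpint q (hint hm hc)]
      exact integral_congr_ae (.of_forall fun t => (hmaxq t).symm)
    rw [this]
    exact hqx _ ⟨h, hm, hc, rfl⟩
  obtain ⟨χ, hχ, hχlim⟩ :=
    exists_subseq_tendsto_limsup_of_integral_le (hpm q) (hpC q) (hpx q) hσ
  refine hmax (W ⊔ Submodule.span ℝ {q}) ⟨ψ ∘ χ, hψ.comp hχ, fun p' hp' => ?_⟩ ?_
  · obtain ⟨r, hr, s, hs, rfl⟩ := Submodule.mem_sup.1 hp'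
    obtain ⟨c, rfl⟩ := Submodule.mem_span_singleton.1 hs
    filter_upwards [hW r hr, hχlim] with t ht1 ht2
    obtain ⟨y, hy⟩ := ht1
    exact ⟨_, (hy.comp hχ.tendsto_atTop).add (ht2.const_mul c)⟩
  · exact lt_of_le_of_ne le_sup_left fun heq => hqW (heq ▸
      Submodule.mem_sup_right (Submodule.mem_span_singleton_self q))

end Fatou

/-- Fatou-type inclusion: `Ls ∫ Fₙ ⊆ ∫ Ls Fₙ` for uniformly integrably bounded
correspondences. -/
theorem Ls_aumannIntegral_subset {ℓ : ℕ} {T : Type*} [MeasurableSpace T]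
    (μ : Measure T) (F : ℕ → T → Set (Fin ℓ → ℝ))
    (g : T → ℝ) (hg : Integrable g μ)
    (hbd : ∀ n t, ∀ x ∈ F n t, ‖x‖ ≤ g t) :
    kuratowskiLs (fun n => aumannIntegral μ (F n)) ⊆
      aumannIntegral μ (fun t => kuratowskiLs (fun n => F n t)) := by
  rintro x ⟨φ, hφ, xk, hxk, hx⟩
  choose f hfi hfF hfx using hxk
  obtain ⟨g', hg'm, hgg'⟩ := hg.aestronglyMeasurable
  let G : T → ℝ := fun t => max (g' t) 0
  have hGm : Measurable G := hg'm.measurable.max measurable_const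
  have hG0 : ∀ t, 0 ≤ G t := fun t => le_max_right _ _
  have hGi : Integrable G μ := (hg.congr hgg').pos_part
  choose f' hf'm hff' using fun k => (hfi k).aestronglyMeasurable
  let u : ℕ → T → Fin ℓ → ℝ := fun k =>
    {t | ‖f' k t‖ ≤ G t}.indicator fun t => (G t)⁻¹ • f' k t
  have hu1 : ∀ k t, ‖f' k t‖ ≤ G t → u k t = (G t)⁻¹ • f' k t := fun k t ht =>
    Set.indicator_of_mem (s := {t | ‖f' k t‖ ≤ G t}) ht _
  have hu0 : ∀ k t, ¬‖f' k t‖ ≤ G t → u k t = 0 := fun k t ht =>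
    Set.indicator_of_notMem (s := {t | ‖f' k t‖ ≤ G t}) ht _
  have hum : ∀ k, Measurable (u k) := fun k =>
    (hGm.inv.smul (hf'm k).measurable).indicator
      (measurableSet_le (hf'm k).measurable.norm hGm)
  have huC : ∀ k t, ‖u k t‖ ≤ 1 := by
    intro k t
    by_cases ht : ‖f' k t‖ ≤ G t
    · rw [hu1 k t ht, norm_smul, norm_inv,
        Real.norm_of_nonneg (hG0 t)]
      exact inv_mul_le_one_of_le₀ ht (hG0 t)
    · rw [hu0 k t ht, norm_zero]
      exact zero_le_one
  have hGu : ∀ᵐ t ∂μ, ∀ k, G t • u k t = f k t ∧ f k t ∈ F (φ k) t := by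
    refine ae_all_iff.2 fun k => ?_
    filter_upwards [hgg', hff' k, hfF k] with t h1 h2 h3
    refine ⟨?_, h3⟩
    have ht : ‖f' k t‖ ≤ G t := by
      rw [← h2]
      exact (hbd _ _ _ h3).trans (h1.trans_le (le_max_left _ _))
    rw [hu1 k t ht, h2]
    rcases eq_or_ne (G t) 0 with h0 | h0
    · rw [h0] at ht ⊢
      rw [norm_le_zero_iff.1 ht, smul_zero, smul_zero]
    · exact smul_inv_smul₀ h0 _
  have hν : ∀ v : T → Fin ℓ → ℝ,
      ∫ t, v t ∂μ.withDensity (fun t => ENNReal.ofReal (G t)) = ∫ t, G t • v t ∂μ := by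
    intro v
    rw [integral_withDensity_eq_integral_toReal_smul hGm.ennreal_ofReal
      (.of_forall fun t => ENNReal.ofReal_lt_top)]
    simp_rw [ENNReal.toReal_ofReal (hG0 _)]
  have : IsFiniteMeasure (μ.withDensity fun t => ENNReal.ofReal (G t)) :=
    isFiniteMeasure_withDensity_ofReal hGi.2
  obtain ⟨h, hm, hc, hint⟩ := mem_clusterIntegral_of_tendsto
    (ν := μ.withDensity fun t => ENNReal.ofReal (G t)) hum huC (x := x) <| by
      refine hx.congr fun k => ?_
      rw [hν, ← hfx k]
      exact integral_congr_ae (hGu.mono fun t ht => (ht k).1.symm)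
  refine ⟨fun t => G t • h t, ?_, ?_, by rw [← hν, hint]⟩
  · refine hGi.mono' (hGm.smul hm).aestronglyMeasurable (.of_forall fun t => ?_)
    rw [norm_smul, Real.norm_of_nonneg (hG0 t)]
    exact mul_le_of_le_one_right (hG0 t) ((hc t).norm_le fun k => huC k t)
  · filter_upwards [hGu] with t ht
    have hcl : MapClusterPt (G t • h t) atTop fun k => G t • u k t :=
      (hc t).continuousAt_comp (continuous_const_smul (G t)).continuousAt
    obtain ⟨ψ, hψ, hlim⟩ := hcl.tendsto_subseq
    exact ⟨φ ∘ ψ, hφ.comp hψ, fun j => f (ψ j) t, fun j => (ht (ψ j)).2,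
      hlim.congr fun j => (ht (ψ j)).1⟩
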